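/- Let S be a smooth ℝ^ℓ-valued function defined on a neighborhood of the origin in ℝ^d × ℝ^{d−ℓ}, with uniformly bounded derivatives, satisfying S(x, x') = x'' for all x near 0 (so that S_{x''}(x,x') is the ℓ×ℓ identity on the diagonal) and S_{x'}(0,0) = 0. Then for every unit vector u ∈ ℝ^{d−ℓ} there exists a smooth ℝ^ℓ-valued function F(·; u), defined on a neighborhood of 0 in ℝ^d and depending smoothly on u, with F(0; u) = 0 and with vanishing first derivatives at 0, such that the map Q(w; u) = (w', w'' + F(w; u)) is a diffeomorphism of a neighborhood of 0, and such that there is a smooth ℝ^ℓ-valued function S̃(·,·; u) with the properties: (a) for x = Q(w; u) and y = Q(z; u) near 0, the relation y'' = S(x, y') holds if and only if z'' = S̃(w, z'; u); and (b) ⟨u, ∇_{z'}⟩ S̃^i(z, z'; u) = 0 for every component i and all z in a neighborhood of 0 (that is, in the new coordinates every directional derivative along u of S̃ on the diagonal vanishes). -/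

import Mathlib

open MeasureTheory
open scoped ENNReal NNReal

noncomputable section

/-- `ℝ^{d-ℓ}`, the `x'` variables. -/
abbrev Vp (d l : ℕ) : Type := EuclideanSpace ℝ (Fin (d - l))

/-- `ℝ^ℓ`, the `x''` variables. -/
abbrev Vpp (l : ℕ) : Type := EuclideanSpace ℝ (Fin l)

/-- `ℝ^d = ℝ^{d-ℓ} × ℝ^ℓ`, with `x = (x', x'')`. -/
abbrev Vf (d l : ℕ) : Type := Vp d l × Vpp l


section Nem
open Set Filter Topology

variable {K : Type} [TopologicalSpace K] [CompactSpace K]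

/-- pointwise application of a continuous family of operators -/
def applyCLM (K : Type) [TopologicalSpace K] [CompactSpace K]
    (E F : Type) [NormedAddCommGroup E] [NormedSpace ℝ E]
    [NormedAddCommGroup F] [NormedSpace ℝ F] :
    C(K, E →L[ℝ] F) →L[ℝ] C(K, E) →L[ℝ] C(K, F) :=
  LinearMap.mkContinuous₂
    (LinearMap.mk₂ ℝ (fun (A : C(K, E →L[ℝ] F)) (h : C(K, E)) =>
        (⟨fun s => A s (h s), by fun_prop⟩ : C(K, F)))
      (fun _ _ _ => by ext; simp) (fun _ _ _ => by ext; simp)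
      (fun _ _ _ => by ext; simp) (fun _ _ _ => by ext; simp)) 1
    (fun A h => by
      rw [ContinuousMap.norm_le _ (by positivity)]
      intro s
      simp only [LinearMap.mk₂_apply, ContinuousMap.coe_mk, one_mul]
      exact (A s).le_of_opNorm_le_of_le (A.norm_coe_le_norm s) (h.norm_coe_le_norm s))

theorem applyCLM_apply {E F : Type} [NormedAddCommGroup E] [NormedSpace ℝ E]
    [NormedAddCommGroup F] [NormedSpace ℝ F] (A : C(K, E →L[ℝ] F)) (h : C(K, E)) (s : K) :
    applyCLM K E F A h s = A s (h s) := rfl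

theorem nem_hasFDerivAt {E F : Type} [NormedAddCommGroup E] [NormedSpace ℝ E]
    [NormedAddCommGroup F] [NormedSpace ℝ F] (f : C(E, F)) (f' : C(E, E →L[ℝ] F))
    (hf : ∀ x, HasFDerivAt f (f' x) x) (γ : C(K, E)) :
    HasFDerivAt (fun γ : C(K, E) => f.comp γ) (applyCLM K E F (f'.comp γ)) γ := by
  rw [hasFDerivAt_iff_isLittleO_nhds_zero, Asymptotics.isLittleO_iff]
  intro ε hε
  have hc : Continuous (fun γ : C(K, E) => f'.comp γ) := ContinuousMap.continuous_postcomp f'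
  obtain ⟨δ, hδ, H⟩ := (Metric.continuousAt_iff (f := fun γ : C(K, E) => f'.comp γ) (a := γ)).1 hc.continuousAt ε hε
  filter_upwards [Metric.ball_mem_nhds (0 : C(K, E)) hδ] with h hh
  rw [mem_ball_zero_iff] at hh
  rw [ContinuousMap.norm_le _ (by positivity)]
  intro s
  have key : ∀ e ∈ Metric.ball (γ s) δ, ‖f' e - f' (γ s)‖ ≤ ε := by
    intro e he
    have h1 : dist (γ + ContinuousMap.const K (e - γ s)) γ < δ := by
      rw [dist_eq_norm, add_sub_cancel_left]
      refine lt_of_le_of_lt ((ContinuousMap.norm_le _ (norm_nonneg (e - γ s))).2 fun x => by simp) ?_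
      rwa [← dist_eq_norm]
    have h2 := (ContinuousMap.dist_apply_le_dist s).trans (H h1).le
    simpa [dist_eq_norm] using h2
  have := (convex_ball (γ s) δ).norm_image_sub_le_of_norm_hasFDerivWithin_le'
    (f := f) (f' := fun x => f' x) (φ := f' (γ s)) (C := ε)
    (fun x _ => (hf x).hasFDerivWithinAt) key (x := γ s) (y := γ s + h s)
    (Metric.mem_ball_self hδ)
    (by simpa using lt_of_le_of_lt (h.norm_coe_le_norm s) hh)
  simp only [add_sub_cancel_left] at this
  refine (le_of_eq ?_).trans (this.trans (by gcongr; exact h.norm_coe_le_norm s))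
  simp [applyCLM_apply]

theorem nem_contDiff_nat (n : ℕ) : ∀ {E F : Type} [NormedAddCommGroup E] [NormedSpace ℝ E]
    [NormedAddCommGroup F] [NormedSpace ℝ F] (f : C(E, F)), ContDiff ℝ n f →
    ContDiff ℝ n (fun γ : C(K, E) => f.comp γ) := by
  induction n with
  | zero =>
    intro E F _ _ _ _ f hf
    simp only [Nat.cast_zero, contDiff_zero]
    exact ContinuousMap.continuous_postcomp f
  | succ n ih =>
    intro E F _ _ _ _ f hf
    push_cast at hf ⊢
    rw [contDiff_succ_iff_hasFDerivAt] at hf ⊢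
    obtain ⟨f', hf', hd⟩ := hf
    refine ⟨fun γ => applyCLM K E F ((⟨f', hf'.continuous⟩ : C(E, E →L[ℝ] F)).comp γ), ?_, ?_⟩
    · exact (applyCLM K E F).contDiff.comp (ih ⟨f', hf'.continuous⟩ hf')
    · exact fun γ => nem_hasFDerivAt f ⟨f', hf'.continuous⟩ hd γ

theorem nem_contDiff {E F : Type} [NormedAddCommGroup E] [NormedSpace ℝ E]
    [NormedAddCommGroup F] [NormedSpace ℝ F] (f : C(E, F)) (hf : ContDiff ℝ (⊤ : ℕ∞) f) :
    ContDiff ℝ (⊤ : ℕ∞) (fun γ : C(K, E) => f.comp γ) := by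
  rw [contDiff_infty] at hf ⊢
  exact fun n => nem_contDiff_nat n f (hf n)

end Nem

section Fix
open Set Filter Topology

/-- Smooth dependence of fixed points on parameters. -/
theorem exists_smooth_fixed {P X : Type} [NormedAddCommGroup P] [NormedSpace ℝ P] [CompleteSpace P]
    [NormedAddCommGroup X] [NormedSpace ℝ X] [CompleteSpace X]
    (T : P × X → X) (hT : ContDiff ℝ (⊤ : ℕ∞) T)
    (hL : ∀ p x y, ‖T (p, x) - T (p, y)‖ ≤ (1/2 : ℝ) * ‖x - y‖) :
    ∃ γ : P → X, ContDiff ℝ (⊤ : ℕ∞) γ ∧ ∀ p x, T (p, x) = x ↔ x = γ p := by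
  have hC : ∀ p, ContractingWith (1/2 : ℝ≥0) (fun x => T (p, x)) := fun p =>
    ⟨by rw [div_lt_one] <;> norm_num, LipschitzWith.of_dist_le_mul fun x y => by
      simpa [dist_eq_norm] using hL p x y⟩
  let γ : P → X := fun p => (hC p).fixedPoint
  have hγ : ∀ p x, T (p, x) = x ↔ x = γ p := fun p x =>
    ⟨fun h => (hC p).fixedPoint_unique h, fun h => by
      rw [h]; exact (hC p).fixedPoint_isFixedPt⟩
  refine ⟨γ, contDiff_iff_contDiffAt.2 fun p => ?_, hγ⟩
  let f : P × X → X := fun q => q.2 - T q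
  have cdf : ContDiffAt ℝ (⊤ : ℕ∞) f (p, γ p) := by
    have : ContDiff ℝ (⊤ : ℕ∞) f := by fun_prop
    exact this.contDiffAt
  have hn : ((⊤ : ℕ∞) : WithTop ℕ∞) ≠ 0 := by simp
  have hTd : DifferentiableAt ℝ T (p, γ p) := hT.contDiffAt.differentiableAt hn
  let A : X →L[ℝ] X := fderiv ℝ T (p, γ p) ∘L .inr ℝ P X
  have hA : HasFDerivAt (fun x => T (p, x)) A (γ p) :=
    hTd.hasFDerivAt.comp (γ p) (hasFDerivAt_prodMk_right p (γ p))
  have hAn : ‖A‖ ≤ 1/2 := by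
    have := hA.le_of_lipschitz (hC p).2
    simpa using this
  have e1 : fderiv ℝ f (p, γ p) ∘L .inr ℝ P X = 1 - A := by
    have : HasFDerivAt f (.snd ℝ P X - fderiv ℝ T (p, γ p)) (p, γ p) :=
      hasFDerivAt_snd.sub hTd.hasFDerivAt
    rw [this.fderiv]
    ext x
    simp [A]
  have if₂ : (fderiv ℝ f (p, γ p) ∘L .inr ℝ P X).IsInvertible := by
    rw [e1]
    let U := Units.oneSub A (by linarith)
    refine ⟨ContinuousLinearEquiv.unitsEquiv ℝ X U, ?_⟩
    ext x
    rfl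
  have h0 : f (p, γ p) = 0 := by simp [f, (hγ p (γ p)).2 rfl]
  have hev := cdf.eventually_apply_implicitFunction hn if₂
  refine (cdf.contDiffAt_implicitFunction hn if₂).congr_of_eventuallyEq ?_
  filter_upwards [hev] with q hq
  rw [h0] at hq
  exact ((hγ q _).1 (sub_eq_zero.1 hq).symm).symm

end Fix

section Flow
open Set Filter Topology

/-- time interval -/
abbrev KI : Type := Icc (-1 : ℝ) 1

/-- projection to the time interval -/
def prI (s : ℝ) : KI := projIcc (-1 : ℝ) 1 (by norm_num) s

theorem continuous_prI : Continuous prI := by unfold prI; exact continuous_projIcc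

theorem prI_val (s : KI) : prI (s : ℝ) = s := projIcc_val _ s

theorem prI_coe {s : ℝ} (h : s ∈ Icc (-1 : ℝ) 1) : ((prI s : KI) : ℝ) = s := by
  unfold prI; rw [projIcc_of_mem _ h]

variable {E : Type} [NormedAddCommGroup E] [NormedSpace ℝ E]

theorem int_bound (k : ℝ → E) (C : ℝ) (hC : 0 ≤ C) (hk : ∀ s, ‖k s‖ ≤ C) (s : KI) :
    ‖∫ σ in (0 : ℝ)..s, k σ‖ ≤ C := by
  have := intervalIntegral.norm_integral_le_of_norm_le_const (a := 0) (b := (s : ℝ)) (f := k)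
    (C := C) (fun x _ => hk x)
  refine this.trans ?_
  have h1 : |(s : ℝ) - 0| ≤ 1 := by rw [sub_zero, abs_le]; exact s.2
  nlinarith

/-- integration from zero, on paths -/
def intCLM (E : Type) [NormedAddCommGroup E] [NormedSpace ℝ E] [CompleteSpace E] :
    C(KI, E) →L[ℝ] C(KI, E) :=
  LinearMap.mkContinuous
    { toFun := fun h => ⟨fun s => ∫ σ in (0 : ℝ)..s, h (prI σ), by
        have h1 : Continuous (fun σ : ℝ => h (prI σ)) := h.continuous.comp continuous_prI
        have h2 : Continuous (fun s : ℝ => ∫ σ in (0 : ℝ)..s, h (prI σ)) :=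
          intervalIntegral.continuous_primitive (fun a b => h1.intervalIntegrable a b) 0
        exact h2.comp continuous_subtype_val⟩
      map_add' := fun h k => by
        ext s
        have h1 : Continuous (fun σ : ℝ => h (prI σ)) := h.continuous.comp continuous_prI
        have h2 : Continuous (fun σ : ℝ => k (prI σ)) := k.continuous.comp continuous_prI
        simp only [ContinuousMap.coe_mk, ContinuousMap.add_apply]
        exact intervalIntegral.integral_add (h1.intervalIntegrable _ _) (h2.intervalIntegrable _ _)
      map_smul' := fun c h => by
        ext s
        simp } 1
    (fun h => by
      rw [ContinuousMap.norm_le _ (by positivity), one_mul]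
      intro s
      exact int_bound (fun σ => h (prI σ)) _ (norm_nonneg _) (fun x => h.norm_coe_le_norm _) s)

theorem intCLM_apply [CompleteSpace E] (h : C(KI, E)) (s : KI) :
    intCLM E h s = ∫ σ in (0 : ℝ)..s, h (prI σ) := rfl

/-- identity path -/
def idPath : C(KI, ℝ) := ⟨fun s => s, continuous_subtype_val⟩

theorem exists_flow {Q E : Type} [NormedAddCommGroup Q] [NormedSpace ℝ Q] [CompleteSpace Q]
    [NormedAddCommGroup E] [NormedSpace ℝ E] [CompleteSpace E]
    (g : Q × ℝ × E → E) (hg : ContDiff ℝ (⊤ : ℕ∞) g)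
    (hL : ∀ q s x y, ‖g (q, s, x) - g (q, s, y)‖ ≤ (1/4 : ℝ) * ‖x - y‖) :
    ∃ Γ : Q × E → C(KI, E), ContDiff ℝ (⊤ : ℕ∞) Γ ∧
      (∀ q y (γ : C(KI, E)), (∀ s : KI, γ s = y + ∫ σ in (0 : ℝ)..s, g (q, (prI σ : ℝ), γ (prI σ)))
        ↔ γ = Γ (q, y)) ∧
      (∀ q y y' s, ‖(Γ (q, y) s - y) - (Γ (q, y') s - y')‖ ≤ (1/2 : ℝ) * ‖y - y'‖) := by
  let gc : C(Q × ℝ × E, E) := ⟨g, hg.continuous⟩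
  let path : (Q × E) × C(KI, E) → C(KI, Q × ℝ × E) := fun z =>
    ContinuousLinearMap.const ℝ KI (z.1.1, (0 : ℝ), (0 : E)) +
    ((ContinuousLinearMap.inr ℝ Q (ℝ × E)).comp (.inl ℝ ℝ E)).compLeftContinuous ℝ KI idPath +
    ((ContinuousLinearMap.inr ℝ Q (ℝ × E)).comp (.inr ℝ ℝ E)).compLeftContinuous ℝ KI z.2
  have hpath : ∀ z s, path z s = (z.1.1, (s : ℝ), z.2 s) := by
    intro z s
    simp [path, idPath]
  have hps : ContDiff ℝ (⊤ : ℕ∞) path := by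
    have h1 : ContDiff ℝ (⊤ : ℕ∞)
        (fun z : (Q × E) × C(KI, E) => ((z.1.1, (0 : ℝ), (0 : E)) : Q × ℝ × E)) := by fun_prop
    have h2 : ContDiff ℝ (⊤ : ℕ∞) (fun z : (Q × E) × C(KI, E) =>
        (ContinuousLinearMap.const ℝ KI : (Q × ℝ × E) →L[ℝ] C(KI, Q × ℝ × E))
          (z.1.1, (0 : ℝ), (0 : E))) :=
      ContinuousLinearMap.contDiff _ |>.comp h1
    have h3 : ContDiff ℝ (⊤ : ℕ∞) (fun z : (Q × E) × C(KI, E) =>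
        ((ContinuousLinearMap.inr ℝ Q (ℝ × E)).comp
          (.inr ℝ ℝ E)).compLeftContinuous ℝ KI z.2) :=
      ContinuousLinearMap.contDiff _ |>.comp contDiff_snd
    exact (h2.add contDiff_const).add h3
  let T : (Q × E) × C(KI, E) → C(KI, E) := fun z =>
    ContinuousLinearMap.const ℝ KI z.1.2 + intCLM E (gc.comp (path z))
  have hTs : ContDiff ℝ (⊤ : ℕ∞) T := by
    have h1 : ContDiff ℝ (⊤ : ℕ∞) (fun z : (Q × E) × C(KI, E) => z.1.2) := by fun_prop
    have h2 : ContDiff ℝ (⊤ : ℕ∞) (fun z : (Q × E) × C(KI, E) =>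
        (ContinuousLinearMap.const ℝ KI : E →L[ℝ] C(KI, E)) z.1.2) :=
      ContinuousLinearMap.contDiff _ |>.comp h1
    have h3 : ContDiff ℝ (⊤ : ℕ∞) (fun γ : C(KI, Q × ℝ × E) => gc.comp γ) :=
      nem_contDiff gc hg
    have h4 : ContDiff ℝ (⊤ : ℕ∞) (fun z => intCLM E (gc.comp (path z))) :=
      (intCLM E).contDiff.comp (h3.comp hps)
    exact h2.add h4
  have hTa : ∀ q y γ s, T ((q, y), γ) s =
      y + ∫ σ in (0 : ℝ)..s, g (q, (prI σ : ℝ), γ (prI σ)) := by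
    intro q y γ s
    simp only [T, ContinuousMap.add_apply, intCLM_apply, ContinuousMap.comp_apply, hpath]
    rfl
  have hD : ∀ q (γ γ' : C(KI, E)) (s : KI),
      ‖(∫ σ in (0 : ℝ)..s, g (q, (prI σ : ℝ), γ (prI σ))) -
        ∫ σ in (0 : ℝ)..s, g (q, (prI σ : ℝ), γ' (prI σ))‖ ≤ (1/4 : ℝ) * ‖γ - γ'‖ := by
    intro q γ γ' s
    have hc : ∀ γ : C(KI, E), Continuous (fun σ : ℝ => g (q, (prI σ : ℝ), γ (prI σ))) := by
      intro γ
      have h1 := hg.continuous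
      have h2 := continuous_prI
      fun_prop
    rw [← intervalIntegral.integral_sub ((hc γ).intervalIntegrable _ _)
      ((hc γ').intervalIntegrable _ _)]
    refine int_bound _ _ (by positivity) (fun σ => ?_) s
    refine (hL _ _ _ _).trans ?_
    gcongr
    exact (γ - γ').norm_coe_le_norm (prI σ)
  obtain ⟨Γ, hΓ, hfix⟩ := exists_smooth_fixed T hTs (by
    rintro ⟨q, y⟩ γ γ'
    rw [ContinuousMap.norm_le _ (by positivity)]
    intro s
    rw [ContinuousMap.sub_apply, hTa, hTa, add_sub_add_left_eq_sub]
    refine (hD q γ γ' s).trans ?_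
    have := norm_nonneg (γ - γ')
    linarith)
  have hfix' : ∀ q y (γ : C(KI, E)),
      (∀ s : KI, γ s = y + ∫ σ in (0 : ℝ)..s, g (q, (prI σ : ℝ), γ (prI σ)))
        ↔ γ = Γ (q, y) := by
    intro q y γ
    rw [← hfix, eq_comm, ContinuousMap.ext_iff]
    simp only [hTa]
  refine ⟨Γ, hΓ, hfix', ?_⟩
  intro q y y' s
  have e1 := (hfix' q y _).2 rfl
  have e2 := (hfix' q y' _).2 rfl
  have h1 : ∀ s, ‖(Γ (q, y) s - y) - (Γ (q, y') s - y')‖ ≤ 1/4 * ‖Γ (q, y) - Γ (q, y')‖ := by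
    intro s
    have e1 := e1 s
    have e2 := e2 s
    rw [e1, e2, add_sub_cancel_left, add_sub_cancel_left]
    exact hD q _ _ s
  have h2 : ‖Γ (q, y) - Γ (q, y')‖ ≤ ‖y - y'‖ + 1/4 * ‖Γ (q, y) - Γ (q, y')‖ := by
    rw [ContinuousMap.norm_le _ (by positivity)]
    intro s
    have : (Γ (q, y) - Γ (q, y')) s = (y - y') + ((Γ (q, y) s - y) - (Γ (q, y') s - y')) := by
      simp only [ContinuousMap.sub_apply]; abel
    rw [this]
    exact (norm_add_le _ _).trans (by gcongr; exact h1 s)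
  have h3 := h1 s
  have h4 := norm_nonneg (y - y')
  linarith

end Flow

section Straight
open Set Filter Topology

theorem exists_straight {V W : Type} [NormedAddCommGroup V] [InnerProductSpace ℝ V]
    [FiniteDimensional ℝ V] [NormedAddCommGroup W] [NormedSpace ℝ W] [CompleteSpace W]
    (G : V × W → V →L[ℝ] W) (hG : ContDiff ℝ (⊤ : ℕ∞) G) (B : ℝ)
    (hB : ∀ x y y', ‖G (x, y) - G (x, y')‖ ≤ B * ‖y - y'‖) :
    ∃ (r : ℝ) (F : V × W → V → W), 0 < r ∧
      ContDiff ℝ (⊤ : ℕ∞) (fun z : (V × W) × V => F z.1 z.2) ∧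
      (∀ x y y' u, ‖F (x, y) u - F (x, y') u‖ ≤ (1/2 : ℝ) * ‖y - y'‖) ∧
      (∀ x y u, inner ℝ x u = 0 → F (x, y) u = 0) ∧
      (∀ x y u, ‖u‖ = 1 → ‖x‖ < r →
        HasDerivAt (fun h : ℝ => F (x + h • u, y) u) (G (x, y + F (x, y) u) u) 0) := by
  have hV : CompleteSpace V := FiniteDimensional.complete ℝ V
  obtain ⟨r, hr, hrB⟩ : ∃ r : ℝ, 0 < r ∧ |B| * (2 * r) ≤ 1/4 := by
    refine ⟨1 / (8 * (|B| + 1)), by positivity, ?_⟩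
    have : 0 ≤ |B| := abs_nonneg B
    have e : |B| * (2 * (1 / (8 * (|B| + 1)))) = (1/4) * (|B| / (|B| + 1)) := by
      field_simp; ring
    rw [e]
    have : |B| / (|B| + 1) ≤ 1 := by rw [div_le_one] <;> linarith
    linarith
  let b : ContDiffBump (0 : V) := ⟨r, 2 * r, hr, by linarith⟩
  let ζ : V → V := fun a => b a • a
  have hζs : ContDiff ℝ (⊤ : ℕ∞) ζ := b.contDiff.smul contDiff_id
  have hζ1 : ∀ a, ‖a‖ ≤ r → ζ a = a := by
    intro a ha
    have : b a = 1 := b.one_of_mem_closedBall (by simpa using ha)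
    simp [ζ, this]
  have hζ2 : ∀ a, ‖ζ a‖ ≤ 2 * r := by
    intro a
    by_cases ha : ‖a‖ < 2 * r
    · simp only [ζ, norm_smul, Real.norm_eq_abs, abs_of_nonneg (b.nonneg : 0 ≤ b a)]
      have h1 : b a ≤ 1 := b.le_one
      have h0 : 0 ≤ b a := b.nonneg
      nlinarith [norm_nonneg a]
    · have : b a = 0 := b.zero_of_le_dist (by simpa using ha)
      simp [ζ, this, hr.le]
  let g : (V × V) × ℝ × W → W := fun z =>
    G (z.1.1 + z.2.1 • ζ z.1.2, z.2.2) (ζ z.1.2)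
  have hg : ContDiff ℝ (⊤ : ℕ∞) g := by
    have h1 : ContDiff ℝ (⊤ : ℕ∞) (fun z : (V × V) × ℝ × W => ζ z.1.2) :=
      hζs.comp (by fun_prop)
    have h2 : ContDiff ℝ (⊤ : ℕ∞) (fun z : (V × V) × ℝ × W =>
      G (z.1.1 + z.2.1 • ζ z.1.2, z.2.2)) := hG.comp (by fun_prop)
    exact h2.clm_apply h1
  have hgL : ∀ q s x y, ‖g (q, s, x) - g (q, s, y)‖ ≤ (1/4 : ℝ) * ‖x - y‖ := by
    intro q s x y
    simp only [g]
    rw [← _root_.sub_apply]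
    refine (ContinuousLinearMap.le_opNorm _ _).trans ?_
    have h1 := hB (q.1 + s • ζ q.2) x y
    have h2 := hζ2 q.2
    have h3 : B * ‖x - y‖ ≤ |B| * ‖x - y‖ := by gcongr; exact le_abs_self B
    calc _ ≤ (|B| * ‖x - y‖) * (2 * r) := by
            gcongr
            exact h1.trans h3
      _ = (|B| * (2 * r)) * ‖x - y‖ := by ring
      _ ≤ _ := by gcongr
  obtain ⟨Γ, hΓ, hfix, hlip⟩ := exists_flow g hg hgL
  let one : KI := ⟨1, by norm_num⟩
  have hcont : ∀ q (γ : C(KI, W)), Continuous (fun σ : ℝ => g (q, (prI σ : ℝ), γ (prI σ))) := by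
    intro q γ
    have h1 := hg.continuous
    have h2 := continuous_prI
    fun_prop
  let F : V × W → V → W := fun w u =>
    Γ ((w.1 - inner ℝ w.1 u • u, inner ℝ w.1 u • u), w.2) one - w.2
  refine ⟨r, F, hr, ?_, ?_, ?_, ?_⟩
  · have hev : ContDiff ℝ (⊤ : ℕ∞) (fun γ : C(KI, W) => γ one) :=
      (ContinuousMap.evalCLM ℝ one : C(KI, W) →L[ℝ] W).contDiff
    have h1 : ContDiff ℝ (⊤ : ℕ∞) (fun z : (V × W) × V =>
      (((z.1.1 - inner ℝ z.1.1 z.2 • z.2, inner ℝ z.1.1 z.2 • z.2), z.1.2) : (V × V) × W)) := by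
      have : ContDiff ℝ (⊤ : ℕ∞) (fun z : (V × W) × V => inner ℝ z.1.1 z.2) :=
        ContDiff.inner ℝ (by fun_prop) (by fun_prop)
      fun_prop
    have h2 : ContDiff ℝ (⊤ : ℕ∞) (fun z : (V × W) × V => z.1.2) := by fun_prop
    exact (hev.comp (hΓ.comp h1)).sub h2
  · intro x y y' u
    exact hlip _ _ _ _
  · intro x y u h
    have := (hfix (x, 0) y _).2 rfl one
    have hz : ζ 0 = 0 := by simp [ζ]
    simp only [g, hz, map_zero, intervalIntegral.integral_zero, add_zero] at this
    simp [F, h, this]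
  · intro x y u hu hx
    set t : ℝ := inner ℝ x u with ht
    have htr : |t| < r := by
      have := abs_real_inner_le_norm x u
      rw [hu, mul_one] at this
      exact this.trans_lt hx
    obtain ⟨R, hR1, hR2⟩ := exists_between htr
    have hR0 : 0 < R := (abs_nonneg t).trans_lt hR1
    set p : V := x - t • u with hp
    have huu : inner ℝ u u = (1 : ℝ) := by rw [real_inner_self_eq_norm_sq, hu]; norm_num
    have hζu : ∀ ρ : ℝ, |ρ| ≤ R → ζ (ρ • u) = ρ • u := by
      intro ρ hρ
      apply hζ1
      rw [norm_smul, hu, mul_one, Real.norm_eq_abs]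
      linarith
    have hF : ∀ h : ℝ, F (x + h • u, y) u = Γ ((p, (t + h) • u), y) one - y := by
      intro h
      have e1 : inner ℝ (x + h • u) u = t + h := by
        rw [inner_add_left, inner_smul_left, huu, ← ht]; simp
      have e2 : x + h • u - (t + h) • u = p := by
        rw [hp, add_smul]; abel
      simp only [F, e1, e2]
    set γR : C(KI, W) := Γ ((p, R • u), y) with hγR
    have eqR := (hfix (p, R • u) y γR).2 rfl
    let k : ℝ → W := fun σ => g ((p, R • u), (prI σ : ℝ), γR (prI σ))
    have hk : Continuous k := hcont _ _
    -- reparametrization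
    have hrep : ∀ ρ : ℝ, |ρ| ≤ R → Γ ((p, ρ • u), y) one = y + ∫ σ in (0 : ℝ)..(ρ / R), k σ := by
      intro ρ hρ
      set c : ℝ := ρ / R with hc
      have hc1 : |c| ≤ 1 := by
        rw [hc, abs_div, abs_of_pos hR0, div_le_one hR0]; exact hρ
      have hcR : c * R = ρ := by rw [hc]; field_simp
      have hmem : ∀ s : ℝ, s ∈ Icc (-1 : ℝ) 1 → c * s ∈ Icc (-1 : ℝ) 1 := by
        intro s hs
        rw [mem_Icc, ← abs_le] at hs ⊢
        rw [abs_mul]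
        exact mul_le_one₀ hc1 (abs_nonneg _) hs
      let γ : C(KI, W) := ⟨fun s => γR (prI (c * s)), by
        have h2 := continuous_prI
        fun_prop⟩
      have hγa : ∀ s, γ s = γR (prI (c * s)) := fun s => rfl
      have hγ : γ = Γ ((p, ρ • u), y) := by
        rw [← hfix]
        intro s
        have e3 : γ s = y + ∫ σ in (0 : ℝ)..(c * s), k σ := by
          have h5 := eqR (prI (c * s))
          rw [prI_coe (hmem _ s.2)] at h5
          exact h5
        rw [e3]
        congr 1
        have e4 := intervalIntegral.smul_integral_comp_mul_left (a := 0) (b := (s : ℝ)) k c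
        rw [mul_zero] at e4
        rw [← e4, ← intervalIntegral.integral_smul]
        apply intervalIntegral.integral_congr
        intro σ hσ
        have hσ' : σ ∈ Icc (-1 : ℝ) 1 := by
          have h6 : uIcc (0 : ℝ) s ⊆ Icc (-1 : ℝ) 1 :=
            uIcc_subset_Icc (by norm_num) s.2
          exact h6 hσ
        simp only [k, g, hγa, prI_coe hσ', prI_coe (hmem _ hσ'), hζu ρ hρ,
          hζu R (abs_of_pos hR0).le]
        have e7 : c • R • u = ρ • u := by rw [smul_smul, hcR]
        have e8 : (c * σ) • R • u = σ • ρ • u := by rw [← e7, smul_smul, smul_smul, smul_smul]; congr 1; ring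
        rw [← ContinuousLinearMap.map_smul, e7, e8]
      rw [← hγ]
      have h5 := eqR (prI c)
      have h7 := hmem 1 (by norm_num)
      rw [mul_one] at h7
      rw [prI_coe h7] at h5
      rw [hγa]
      simpa [one] using h5
    -- differentiate
    have hY : HasDerivAt (fun s : ℝ => ∫ σ in (0 : ℝ)..s, k σ) (k (t / R)) (t / R) :=
      hk.integral_hasStrictDerivAt 0 (t / R) |>.hasDerivAt
    have hin : HasDerivAt (fun h : ℝ => (t + h) / R) (1 / R) 0 :=
      ((hasDerivAt_id (0 : ℝ)).const_add t).div_const R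
    have hcomp : HasDerivAt (fun h : ℝ => ∫ σ in (0 : ℝ)..((t + h) / R), k σ)
        ((1 / R) • k (t / R)) 0 := by
      refine HasDerivAt.scomp (𝕜 := ℝ) (h := fun h : ℝ => (t + h) / R)
        (g₁ := fun s : ℝ => ∫ σ in (0 : ℝ)..s, k σ) 0 ?_ hin
      simpa using hY
    have hval : (1 / R) • k (t / R) = G (x, y + F (x, y) u) u := by
      have hm : t / R ∈ Icc (-1 : ℝ) 1 := by
        rw [mem_Icc, ← abs_le, abs_div, abs_of_pos hR0, div_le_one hR0]; exact hR1.le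
      have e5 : y + F (x, y) u = γR (prI (t / R)) := by
        have h8 := hF 0
        rw [zero_smul, add_zero, add_zero] at h8
        have h9 := eqR (prI (t / R))
        rw [prI_coe hm] at h9
        rw [h8, hrep t hR1.le, h9]
        simp only [k]
        abel
      rw [e5]
      simp only [k, g, prI_coe hm, hζu R (abs_of_pos hR0).le]
      have e6 : p + (t / R) • R • u = x := by
        rw [smul_smul, div_mul_cancel₀ _ hR0.ne', hp]; abel
      rw [e6, ContinuousLinearMap.map_smul, smul_smul, one_div, inv_mul_cancel₀ hR0.ne', one_smul]
    rw [← hval]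
    refine hcomp.congr_of_eventuallyEq ?_
    have hopen : ∀ᶠ h in 𝓝 (0 : ℝ), |t + h| < R := by
      have : ContinuousAt (fun h : ℝ => |t + h|) 0 := by fun_prop
      exact this.eventually_lt continuousAt_const (by simpa using hR1)
    filter_upwards [hopen] with h hh
    rw [hF, hrep _ hh.le]
    abel

end Straight

section Final
open Set Filter Topology

theorem straighten_aux {V W : Type} [NormedAddCommGroup V] [InnerProductSpace ℝ V]
    [FiniteDimensional ℝ V] [NormedAddCommGroup W] [NormedSpace ℝ W] [CompleteSpace W]
    (S : V × W → V → W)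
    (hSsm : ContDiff ℝ (⊤ : ℕ∞) (fun z : (V × W) × V => S z.1 z.2))
    (hSbd : ∀ k : ℕ, ∃ B : ℝ, ∀ z : (V × W) × V,
      ‖iteratedFDeriv ℝ k (fun z : (V × W) × V => S z.1 z.2) z‖ ≤ B)
    (ε₀ : ℝ) (hε₀ : 0 < ε₀)
    (hdiag : ∀ x : V × W, ‖x‖ < ε₀ → S x x.1 = x.2)
    (hSx : fderiv ℝ (fun t : V => S (t, (0 : W)) 0) 0 = 0) :
    ∃ (ε₁ : ℝ) (F : V × W → V → W) (St : V × W → V → V → W),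
      0 < ε₁ ∧
      ContDiff ℝ (⊤ : ℕ∞) (fun z : (V × W) × V => F z.1 z.2) ∧
      ContDiff ℝ (⊤ : ℕ∞)
        (fun z : ((V × W) × V) × V => St z.1.1 z.1.2 z.2) ∧
      ∀ u : V, ‖u‖ = 1 →
        F 0 u = 0 ∧
        fderiv ℝ (fun w : V × W => F w u) 0 = 0 ∧
        (∃ e : PartialHomeomorph (V × W) (V × W),
          e.source = Metric.ball 0 ε₁ ∧
          (∀ w ∈ Metric.ball (0 : V × W) ε₁, e w = (w.1, w.2 + F w u)) ∧
          ContDiffOn ℝ (⊤ : ℕ∞) e.symm e.target) ∧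
        (∀ w z : V × W, w ∈ Metric.ball (0 : V × W) ε₁ → z ∈ Metric.ball (0 : V × W) ε₁ →
          (z.2 + F z u = S (w.1, w.2 + F w u) z.1 ↔ z.2 = St w z.1 u)) ∧
        (∀ z : V × W, z ∈ Metric.ball (0 : V × W) ε₁ →
          fderiv ℝ (fun z' : V => St z z' u) z.1 u = 0) := by
  have hV : CompleteSpace V := FiniteDimensional.complete ℝ V
  have hn : ((⊤ : ℕ∞) : WithTop ℕ∞) ≠ 0 := by simp
  let Sf : (V × W) × V → W := fun z => S z.1 z.2
  have hSf : ContDiff ℝ (⊤ : ℕ∞) Sf := hSsm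
  have hSd : Differentiable ℝ Sf := hSf.differentiable hn
  have hS' : ContDiff ℝ (⊤ : ℕ∞) (fderiv ℝ Sf) := hSf.fderiv_right (by simp)
  obtain ⟨B, hB⟩ := hSbd 2
  have hB0 : 0 ≤ B := (norm_nonneg _).trans (hB 0)
  have hlipS : ∀ a b, ‖fderiv ℝ Sf a - fderiv ℝ Sf b‖ ≤ B * ‖a - b‖ := by
    intro a b
    refine convex_univ.norm_image_sub_le_of_norm_fderiv_le (f := fderiv ℝ Sf) (𝕜 := ℝ)
      (fun x _ => (hS'.differentiable hn) x) (fun x _ => ?_) (mem_univ b) (mem_univ a)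
    have h1 := norm_iteratedFDeriv_fderiv (𝕜 := ℝ) (f := Sf) (x := x) (n := 1)
    have h2 := norm_iteratedFDeriv_one (𝕜 := ℝ) (f := fderiv ℝ Sf) (x := x)
    rw [← h2, h1]
    exact hB x
  let G : V × W → V →L[ℝ] W := fun x => (fderiv ℝ Sf (x, x.1)).comp (.inr ℝ (V × W) V)
  have hG : ContDiff ℝ (⊤ : ℕ∞) G := by
    have h1 : ContDiff ℝ (⊤ : ℕ∞) (fun x : V × W => fderiv ℝ Sf (x, x.1)) :=
      hS'.comp (by fun_prop)
    exact h1.clm_comp contDiff_const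
  have hGd : ∀ x : V × W, HasFDerivAt (fun y => S x y) (G x) x.1 := fun x =>
    (hSd (x, x.1)).hasFDerivAt.comp x.1 (hasFDerivAt_prodMk_right x x.1)
  have hGB : ∀ x y y', ‖G (x, y) - G (x, y')‖ ≤ B * ‖y - y'‖ := by
    intro x y y'
    have h1 := hlipS ((x, y), x) ((x, y'), x)
    have h2 : ‖((((x, y), x) : (V × W) × V) - ((x, y'), x))‖ = ‖y - y'‖ := by
      simp [Prod.norm_def]
    rw [h2] at h1
    have h3 : G (x, y) - G (x, y') =
      (fderiv ℝ Sf ((x, y), x) - fderiv ℝ Sf ((x, y'), x)).comp (.inr ℝ (V × W) V) := by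
      simp [G, ContinuousLinearMap.sub_comp]
    rw [h3]
    refine (ContinuousLinearMap.opNorm_comp_le _ _).trans ?_
    have h4 := ContinuousLinearMap.norm_inr_le_one ℝ (V × W) V
    calc _ ≤ (B * ‖y - y'‖) * 1 := by gcongr
      _ = _ := mul_one _
  -- the derivative at the origin vanishes
  have hG0 : G 0 = 0 := by
    have h1 : HasFDerivAt (fun t : V => Sf ((t, (0 : W)), t))
        ((fderiv ℝ Sf 0).comp (((ContinuousLinearMap.id ℝ V).prod (0 : V →L[ℝ] W)).prod
          (ContinuousLinearMap.id ℝ V))) 0 := by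
      refine HasFDerivAt.comp (0 : V) (g := Sf) (f := fun t : V => ((t, (0 : W)), t)) ?_ ?_
      · exact (hSd _).hasFDerivAt
      · exact ((hasFDerivAt_id (0 : V)).prodMk (hasFDerivAt_const (0 : W) (0 : V))).prodMk
          (hasFDerivAt_id (0 : V))
    have h2 : HasFDerivAt (fun t : V => Sf ((t, (0 : W)), t)) (0 : V →L[ℝ] W) 0 := by
      refine (hasFDerivAt_const (0 : W) (0 : V)).congr_of_eventuallyEq ?_
      filter_upwards [Metric.ball_mem_nhds (0 : V) hε₀] with t ht
      rw [mem_ball_zero_iff] at ht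
      exact hdiag (t, 0) (by simpa [Prod.norm_def] using ht)
    have h3 : HasFDerivAt (fun t : V => S (t, (0 : W)) 0)
        ((fderiv ℝ Sf 0).comp (((ContinuousLinearMap.id ℝ V).prod (0 : V →L[ℝ] W)).prod
          (0 : V →L[ℝ] V))) 0 := by
      refine HasFDerivAt.comp (0 : V) (g := Sf) (f := fun t : V => ((t, (0 : W)), (0 : V))) ?_ ?_
      · exact (hSd _).hasFDerivAt
      · exact ((hasFDerivAt_id (0 : V)).prodMk (hasFDerivAt_const (0 : W) (0 : V))).prodMk
          (hasFDerivAt_const (0 : V) (0 : V))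
    have e1 := h1.unique h2
    have e2 := h3.fderiv.symm.trans hSx
    ext v
    have e1v := congrArg (fun L : V →L[ℝ] W => L v) e1
    have e2v := congrArg (fun L : V →L[ℝ] W => L v) e2
    simp only [ContinuousLinearMap.comp_apply, ContinuousLinearMap.prod_apply,
      ContinuousLinearMap.id_apply, _root_.zero_apply] at e1v e2v
    have e3 : (((v, (0 : W)), v) : (V × W) × V) = ((v, 0), 0) + (0, v) := by simp
    rw [e3, map_add, e2v, zero_add] at e1v
    exact e1v
  obtain ⟨r, F, hr, hFs, hFL, hF0, hFd⟩ := exists_straight G hG B hGB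
  have hFz : ∀ y u, F (0, y) u = 0 := fun y u => hF0 0 y u (by simp)
  -- solving z'' + F = v
  let T : (V × V × W) × W → W := fun z => z.1.2.2 - F (z.1.1, z.2) z.1.2.1
  have hT : ContDiff ℝ (⊤ : ℕ∞) T := by
    have h1 : ContDiff ℝ (⊤ : ℕ∞) (fun z : (V × V × W) × W => F (z.1.1, z.2) z.1.2.1) :=
      hFs.comp (g := fun z : (V × W) × V => F z.1 z.2)
        (f := fun z : (V × V × W) × W => ((z.1.1, z.2), z.1.2.1)) (by fun_prop)
    have h2 : ContDiff ℝ (⊤ : ℕ∞) (fun z : (V × V × W) × W => z.1.2.2) := by fun_prop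
    exact h2.sub h1
  obtain ⟨Y, hY, hYfix⟩ := exists_smooth_fixed T hT (by
    rintro ⟨p, u, v⟩ x y
    simp only [T, sub_sub_sub_cancel_left]
    rw [norm_sub_rev x y]
    exact hFL p y x u)
  have hYiff : ∀ p u v y, y + F (p, y) u = v ↔ y = Y (p, u, v) := by
    intro p u v y
    rw [← hYfix, eq_comm, ← sub_eq_iff_eq_add]
  let St : V × W → V → V → W := fun w z' u => Y (z', u, S (w.1, w.2 + F w u) z')
  have hSts : ContDiff ℝ (⊤ : ℕ∞) (fun z : ((V × W) × V) × V => St z.1.1 z.1.2 z.2) := by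
    have h1 : ContDiff ℝ (⊤ : ℕ∞) (fun z : ((V × W) × V) × V => F z.1.1 z.2) :=
      hFs.comp (g := fun z : (V × W) × V => F z.1 z.2)
        (f := fun z : ((V × W) × V) × V => (z.1.1, z.2)) (by fun_prop)
    have h2 : ContDiff ℝ (⊤ : ℕ∞) (fun z : ((V × W) × V) × V =>
        S (z.1.1.1, z.1.1.2 + F z.1.1 z.2) z.1.2) :=
      hSf.comp (f := fun z : ((V × W) × V) × V =>
        ((z.1.1.1, z.1.1.2 + F z.1.1 z.2), z.1.2)) (by fun_prop)
    exact hY.comp (f := fun z : ((V × W) × V) × V =>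
      (z.1.2, z.2, S (z.1.1.1, z.1.1.2 + F z.1.1 z.2) z.1.2)) (by fun_prop)
  -- choice of the radius
  obtain ⟨δ, hδ, hδF⟩ : ∃ δ > 0, ∀ w : V × W, ‖w‖ < δ → ∀ u : V, ‖u‖ = 1 →
      ‖((w.1, w.2 + F w u) : V × W)‖ < ε₀ := by
    have hcpt : IsCompact (Metric.sphere (0 : V) 1) := isCompact_sphere 0 1
    let q : (V × W) × V → ℝ := fun z => ‖((z.1.1, z.1.2 + F z.1 z.2) : V × W)‖
    have hq : Continuous q := by
      have := hFs.continuous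
      fun_prop
    have hev : ∀ᶠ w in 𝓝 (0 : V × W), ∀ u ∈ Metric.sphere (0 : V) 1, q (w, u) < ε₀ := by
      apply hcpt.eventually_forall_of_forall_eventually
      intro u _
      have h0 : q (0, u) < ε₀ := by
        have := hFz 0 u
        have h5 : F 0 u = 0 := this
        simp [q, h5, hε₀]
      exact hq.continuousAt.eventually_lt continuousAt_const h0
    obtain ⟨δ, hδ, h⟩ := Metric.eventually_nhds_iff_ball.1 hev
    exact ⟨δ, hδ, fun w hw u hu => h w (by simpa using hw) u (by simpa using hu)⟩
  refine ⟨min r δ, F, St, lt_min hr hδ, hFs, hSts, ?_⟩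
  intro u hu
  have hFu : ContDiff ℝ (⊤ : ℕ∞) (fun w : V × W => F w u) :=
    hFs.comp (g := fun z : (V × W) × V => F z.1 z.2)
      (f := fun w : V × W => (w, u)) (by fun_prop)
  have hFud : Differentiable ℝ (fun w : V × W => F w u) := hFu.differentiable hn
  have hline : ∀ (w v : V × W), HasDerivAt (fun h : ℝ => w + h • v) v 0 := by
    intro w v
    simpa using ((hasDerivAt_id (0 : ℝ)).smul_const v).const_add w
  have hdir : ∀ (w v : V × W), HasDerivAt (fun h : ℝ => F (w + h • v) u)
      (fderiv ℝ (fun w : V × W => F w u) w v) 0 := by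
    intro w v
    have h1 : HasFDerivAt (fun w : V × W => F w u) (fderiv ℝ (fun w : V × W => F w u) w)
      (w + (0 : ℝ) • v) := by
      rw [zero_smul, add_zero]; exact (hFud w).hasFDerivAt
    exact h1.comp_hasDerivAt (0 : ℝ) (hline w v)
  have hdu : ∀ x y, ‖x‖ < r →
      fderiv ℝ (fun w : V × W => F w u) (x, y) (u, 0) = G (x, y + F (x, y) u) u := by
    intro x y hx
    refine (hdir (x, y) (u, 0)).unique ?_
    have := hFd x y u hu hx
    simpa using this
  have hF00 : F 0 u = 0 := hFz 0 u
  refine ⟨hF00, ?_, ?_, ?_, ?_⟩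
  · refine ContinuousLinearMap.ext fun v => ?_
    have e1 : v = (v.1 - inner ℝ v.1 u • u, v.2) + (inner ℝ v.1 u : ℝ) • ((u, 0) : V × W) := by
      ext <;> simp
    have h1 : fderiv ℝ (fun w : V × W => F w u) 0 (v.1 - inner ℝ v.1 u • u, v.2) = 0 := by
      refine (hdir 0 _).unique ?_
      refine (hasDerivAt_const (0 : ℝ) (0 : W)).congr_of_eventuallyEq
        (Filter.Eventually.of_forall fun h => ?_)
      have : (0 : V × W) + h • (v.1 - inner ℝ v.1 u • u, v.2) =
        (h • (v.1 - inner ℝ v.1 u • u), h • v.2) := by simp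
      simp only [this]
      apply hF0
      rw [inner_smul_left, inner_sub_left, inner_smul_left, real_inner_self_eq_norm_sq, hu]
      simp
    have h2 := hdu 0 0 (by simpa using hr)
    rw [hFz] at h2
    have h3 : G (0, (0 : W) + 0) = 0 := by rw [add_zero]; exact hG0
    rw [h3] at h2
    conv_lhs => rw [e1, map_add, h1, map_smul]
    have h4 : fderiv ℝ (fun w : V × W => F w u) 0 (u, 0) = 0 := h2
    rw [h4]; simp
  · have hc1 : Continuous (fun w : V × W => ((w.1, w.2 + F w u) : V × W)) := by
      have := hFu.continuous
      fun_prop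
    have hs2 : ContDiff ℝ (⊤ : ℕ∞) (fun w : V × W => ((w.1, Y (w.1, u, w.2)) : V × W)) := by
      have : ContDiff ℝ (⊤ : ℕ∞) (fun w : V × W => Y (w.1, u, w.2)) := hY.comp (by fun_prop)
      fun_prop
    let e : (V × W) ≃ₜ (V × W) :=
      { toFun := fun w => (w.1, w.2 + F w u)
        invFun := fun w => (w.1, Y (w.1, u, w.2))
        left_inv := fun w => by
          ext1
          · rfl
          · exact ((hYiff w.1 u _ w.2).1 rfl).symm
        right_inv := fun w => by
          ext1
          · rfl
          · exact (hYiff w.1 u w.2 _).2 rfl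
        continuous_toFun := hc1
        continuous_invFun := hs2.continuous }
    refine ⟨e.toPartialHomeomorphOfImageEq (Metric.ball 0 (min r δ)) _ rfl, rfl,
      fun w _ => rfl, ?_⟩
    exact hs2.contDiffOn
  · intro w z _ _
    exact hYiff z.1 u _ z.2
  · rintro ⟨x, y⟩ hz
    rw [mem_ball_zero_iff, lt_min_iff] at hz
    have hx : ‖x‖ < r := lt_of_le_of_lt (norm_fst_le (x, y)) hz.1
    set X : V × W := (x, y + F (x, y) u) with hX
    have hXd : S X x = y + F (x, y) u := hdiag X (hδF (x, y) hz.2 u hu)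
    have hStd : DifferentiableAt ℝ (fun z' : V => St (x, y) z' u) x := by
      have : ContDiff ℝ (⊤ : ℕ∞) (fun z' : V => St (x, y) z' u) :=
        hSts.comp (g := fun z : ((V × W) × V) × V => St z.1.1 z.1.2 z.2)
          (f := fun z' : V => (((x, y), z'), u)) (by fun_prop)
      exact this.differentiable hn x
    set D := fderiv ℝ (fun z' : V => St (x, y) z' u) x with hD
    have hSt0 : St (x, y) x u = y := ((hYiff x u _ y).1 hXd.symm).symm
    have heq : (fun z' : V => St (x, y) z' u + F (z', St (x, y) z' u) u) = fun z' => S X z' := by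
      funext z'
      exact (hYiff z' u _ _).2 rfl
    have hFx : HasFDerivAt (fun w : V × W => F w u) (fderiv ℝ (fun w : V × W => F w u) (x, y))
        (x, St (x, y) x u) := by
      rw [hSt0]; exact (hFud (x, y)).hasFDerivAt
    have hcmp : HasFDerivAt (fun z' : V => F (z', St (x, y) z' u) u)
        ((fderiv ℝ (fun w : V × W => F w u) (x, y)).comp ((ContinuousLinearMap.id ℝ V).prod D)) x :=
      hFx.comp (f := fun z' : V => (z', St (x, y) z' u)) x
        ((hasFDerivAt_id x).prodMk hStd.hasFDerivAt)
    have h1 := hStd.hasFDerivAt.add hcmp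
    have h2 : HasFDerivAt (fun z' : V => St (x, y) z' u + F (z', St (x, y) z' u) u) (G X) x := by
      rw [heq]; exact hGd X
    have h3 := congrArg (fun L : V →L[ℝ] W => L u) (h1.unique h2)
    simp only [_root_.add_apply, ContinuousLinearMap.comp_apply, ContinuousLinearMap.prod_apply,
      ContinuousLinearMap.id_apply] at h3
    have e1 : ((u, D u) : V × W) = (u, 0) + (0, D u) := by simp
    rw [e1, map_add, hdu x y hx] at h3
    have h4 : D u = - fderiv ℝ (fun w : V × W => F w u) (x, y) (0, D u) := by
      rw [eq_neg_iff_add_eq_zero]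
      have : D u + (G X u + fderiv ℝ (fun w : V × W => F w u) (x, y) (0, D u)) = G X u := h3
      rw [← add_assoc, add_comm (D u), add_assoc] at this
      simpa using this
    have hpart : HasFDerivAt (fun y' : W => F (x, y') u)
        ((fderiv ℝ (fun w : V × W => F w u) (x, y)).comp (.inr ℝ V W)) y :=
      (hFud (x, y)).hasFDerivAt.comp y (hasFDerivAt_prodMk_right x y)
    have hpl : LipschitzWith (1/2 : ℝ≥0) (fun y' : W => F (x, y') u) :=
      LipschitzWith.of_dist_le_mul fun a b => by
        simpa [dist_eq_norm] using hFL x a b u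
    have h5 := hpart.le_of_lipschitz hpl
    have h6 := ContinuousLinearMap.le_of_opNorm_le _ h5 (D u)
    have h7 : ‖D u‖ = ‖((fderiv ℝ (fun w : V × W => F w u) (x, y)).comp
        (.inr ℝ V W)) (D u)‖ := by
      conv_lhs => rw [h4]
      rw [norm_neg]; rfl
    rw [← h7] at h6
    have h8 : ((1/2 : ℝ≥0) : ℝ) = 1/2 := by norm_num
    rw [h8] at h6
    have h9 := norm_nonneg (D u)
    exact norm_eq_zero.1 (by linarith)

end Final

/-- **§2.2, Straightening near the diagonal.** The change of variables
`Q(w;u) = (w', w'' + F(w;u))` with `⟨u,∇_{z'}⟩ S̃(z,z';u) = 0`. -/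
theorem statement19 (d l : ℕ) (hl : 1 ≤ l) (hld : l < d)
    (S : Vf d l → Vp d l → Vpp l)
    (hSsm : ContDiff ℝ (⊤ : ℕ∞) (fun z : Vf d l × Vp d l => S z.1 z.2))
    (hSbd : ∀ k : ℕ, ∃ B : ℝ, ∀ z : Vf d l × Vp d l,
      ‖iteratedFDeriv ℝ k (fun z : Vf d l × Vp d l => S z.1 z.2) z‖ ≤ B)
    (ε₀ : ℝ) (hε₀ : 0 < ε₀)
    (hdiag : ∀ x : Vf d l, ‖x‖ < ε₀ → S x x.1 = x.2)
    (hSx : fderiv ℝ (fun t : Vp d l => S (t, (0 : Vpp l)) 0) 0 = 0) :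
    ∃ (ε₁ : ℝ) (F : Vf d l → Vp d l → Vpp l) (St : Vf d l → Vp d l → Vp d l → Vpp l),
      0 < ε₁ ∧
      ContDiff ℝ (⊤ : ℕ∞) (fun z : Vf d l × Vp d l => F z.1 z.2) ∧
      ContDiff ℝ (⊤ : ℕ∞)
        (fun z : (Vf d l × Vp d l) × Vp d l => St z.1.1 z.1.2 z.2) ∧
      ∀ u : Vp d l, ‖u‖ = 1 →
        F 0 u = 0 ∧
        fderiv ℝ (fun w : Vf d l => F w u) 0 = 0 ∧
        (∃ e : PartialHomeomorph (Vf d l) (Vf d l),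
          e.source = Metric.ball 0 ε₁ ∧
          (∀ w ∈ Metric.ball (0 : Vf d l) ε₁, e w = (w.1, w.2 + F w u)) ∧
          ContDiffOn ℝ (⊤ : ℕ∞) e.symm e.target) ∧
        (∀ w z : Vf d l, w ∈ Metric.ball (0 : Vf d l) ε₁ → z ∈ Metric.ball (0 : Vf d l) ε₁ →
          (z.2 + F z u = S (w.1, w.2 + F w u) z.1 ↔ z.2 = St w z.1 u)) ∧
        (∀ z : Vf d l, z ∈ Metric.ball (0 : Vf d l) ε₁ →
          fderiv ℝ (fun z' : Vp d l => St z z' u) z.1 u = 0) := by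
  exact straighten_aux S hSsm hSbd ε₀ hε₀ hdiag hSx

end
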